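/- Let k > 1 be a triangular number. Then the binary representations of both t_{2^k - 2} and t_{2^k - 1} contain exactly k ones; in particular, t_{2^k - 2} and t_{2^k - 1} are a pair of consecutive triangular numbers that are both very triangular. -/

import Mathlib

/-- The n-th triangular number. -/
def triangular (n : ℕ) : ℕ := n * (n + 1) / 2

/-- A natural number is triangular if it is `triangular n` for some `n`. -/
def IsTriangular (m : ℕ) : Prop := ∃ n : ℕ, triangular n = m

/-- The number of 1s in the binary representation of `m` (binary digit sum). -/
def binOnes (m : ℕ) : ℕ := (Nat.digits 2 m).sum

/-- A number is very triangular if it is triangular and its binary digit sum is triangular. -/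
def IsVeryTriangular (m : ℕ) : Prop := IsTriangular m ∧ IsTriangular (binOnes m)

theorem binOnes_two_mul (m : ℕ) : binOnes (2 * m) = binOnes m := by
  rcases Nat.eq_zero_or_pos m with rfl | hm
  · simp
  · have h := Nat.digits_add 2 one_lt_two 0 m two_pos (Or.inr hm.ne')
    rw [zero_add] at h
    simp [binOnes, h]

theorem binOnes_two_mul_add_one (m : ℕ) : binOnes (2 * m + 1) = binOnes m + 1 := by
  have h := Nat.digits_add 2 one_lt_two 1 m one_lt_two (Or.inl one_ne_zero)
  rw [add_comm 1] at h
  rw [binOnes, h, List.sum_cons, binOnes, add_comm]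

theorem binOnes_two_pow_mul (a m : ℕ) : binOnes (2 ^ a * m) = binOnes m := by
  induction a with
  | zero => simp
  | succ a ih => rw [pow_succ', mul_assoc, binOnes_two_mul, ih]

theorem binOnes_two_pow_sub_one (a : ℕ) : binOnes (2 ^ a - 1) = a := by
  induction a with
  | zero => simp [binOnes]
  | succ a ih =>
    have h : 2 ^ (a + 1) - 1 = 2 * (2 ^ a - 1) + 1 := by
      have := Nat.one_le_two_pow (n := a)
      rw [pow_succ']
      omega
    rw [h, binOnes_two_mul_add_one, ih]

theorem triangular_eq_of_two_mul {n m : ℕ} (h : n * (n + 1) = 2 * m) : triangular n = m := by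
  simp [triangular, h]

theorem binOnes_triangular_two_pow_sub_one (k : ℕ) :
    binOnes (triangular (2 ^ k - 1)) = k := by
  cases k with
  | zero => simp [triangular, binOnes]
  | succ j =>
    have h : triangular (2 ^ (j + 1) - 1) = 2 ^ j * (2 ^ (j + 1) - 1) := by
      apply triangular_eq_of_two_mul
      rw [Nat.sub_add_cancel Nat.one_le_two_pow, pow_succ]
      ring
    rw [h, binOnes_two_pow_mul, binOnes_two_pow_sub_one]

theorem binOnes_triangular_two_pow_sub_two {k : ℕ} (hk : 1 < k) :
    binOnes (triangular (2 ^ k - 2)) = k := by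
  obtain ⟨j, rfl⟩ := Nat.exists_eq_add_of_le' hk
  have h : triangular (2 ^ (j + 2) - 2) = 2 * (2 ^ j * (2 * (2 * (2 ^ j - 1)) + 1)) + 1 := by
    apply triangular_eq_of_two_mul
    obtain ⟨x, hx⟩ := Nat.exists_eq_add_of_le' (Nat.one_le_two_pow (n := j))
    have hsub : 2 ^ (j + 2) - 2 = 4 * x + 2 := by
      rw [pow_add, hx]
      omega
    rw [hsub, hx, Nat.add_sub_cancel]
    ring
  rw [h, binOnes_two_mul_add_one, binOnes_two_pow_mul, binOnes_two_mul_add_one,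
    binOnes_two_mul, binOnes_two_pow_sub_one]

theorem stmt10 (k : ℕ) (hk : IsTriangular k) (hk1 : k > 1) :
    binOnes (triangular (2 ^ k - 2)) = k ∧ binOnes (triangular (2 ^ k - 1)) = k ∧
      IsVeryTriangular (triangular (2 ^ k - 2)) ∧ IsVeryTriangular (triangular (2 ^ k - 1)) := by
  have h₂ := binOnes_triangular_two_pow_sub_two hk1
  have h₁ := binOnes_triangular_two_pow_sub_one k
  exact ⟨h₂, h₁, ⟨⟨_, rfl⟩, h₂.symm ▸ hk⟩, ⟨⟨_, rfl⟩, h₁.symm ▸ hk⟩⟩
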